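/- arXiv:1204.4854 — 4 statements merged into one kernel-verified Lean document; each statement's English description precedes it below -/
import Mathlib

section
/- Let λ ≥ 0 and let Z be a random variable with the Poisson distribution of parameter λ. Let f : ℕ → ℝ and g : ℕ → ℝ be bounded functions. Then for every n ∈ ℕ, E[f(Z) · (Z · g(Z))^n] = ∑_{k=0}^n S(n,k) · λ^k · E[f(Z+k) · g(Z+k)^n], where S(n,k) denotes the Stirling number of the second kind. -/
open MeasureTheory Finset

/-- Stirling number of the second kind: the number of partitions of a set of `n`
elements into `k` non-empty subsets. -/
noncomputable def stirling2 (n k : ℕ) : ℕ :=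
  Nat.card {P : Finpartition (Finset.univ : Finset (Fin n)) // P.parts.card = k}

/-- A map out of a finite type is the same as a partition of its domain together with an
injective labelling of the parts. -/
theorem bijective_sigma_parts_embedding {α β : Type*} [Fintype α] [DecidableEq α] :
    Function.Bijective
      (fun (p : Σ P : Finpartition (univ : Finset α), {s // s ∈ P.parts} ↪ β) (x : α) ↦
        p.2 ⟨p.1.part x, p.1.part_mem.2 (mem_univ x)⟩) := by
  classical
  constructor
  · rintro ⟨P, e⟩ ⟨Q, e'⟩ h
    have hiff (R : Finpartition (univ : Finset α)) (i : {s // s ∈ R.parts} ↪ β) (x y : α) :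
        x ∈ R.part y ↔ i ⟨R.part x, R.part_mem.2 (mem_univ x)⟩ =
          i ⟨R.part y, R.part_mem.2 (mem_univ y)⟩ := by
      rw [R.mem_part_iff_part_eq_part (mem_univ x) (mem_univ y), i.injective.eq_iff,
        Subtype.mk.injEq]
    have hpart (x : α) : P.part x = Q.part x := by
      ext y
      rw [hiff P e, hiff Q e']
      have hx := congrFun h x
      have hy := congrFun h y
      dsimp only at hx hy
      rw [hx, hy]
    have hparts (R : Finpartition (univ : Finset α)) : R.parts = univ.image R.part := by
      ext s
      simp only [mem_image, mem_univ, true_and]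
      constructor
      · intro hs
        obtain ⟨x, hx⟩ := R.nonempty_of_mem_parts hs
        exact ⟨x, R.part_eq_of_mem hs hx⟩
      · rintro ⟨x, rfl⟩
        exact R.part_mem.2 (mem_univ x)
    obtain rfl : P = Q := by
      ext1
      rw [hparts P, hparts Q, funext hpart]
    congr 1
    ext ⟨s, hs⟩
    obtain ⟨x, hx⟩ := P.nonempty_of_mem_parts hs
    obtain rfl := P.part_eq_of_mem hs hx
    exact congrFun h x
  · intro f
    let P := Finpartition.ofSetoid (Setoid.ker f)
    have hmem {x y : α} : y ∈ P.part x ↔ f x = f y := Finpartition.mem_part_ofSetoid_iff_rel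
    choose r hr using fun s : {s // s ∈ P.parts} ↦ P.nonempty_of_mem_parts s.2
    refine ⟨⟨P, fun s ↦ f (r s), fun s t hst ↦ ?_⟩, funext fun x ↦ ?_⟩
    · have hs := P.part_eq_of_mem s.2 (hr s)
      have h := hmem.2 hst
      rw [hs] at h
      exact Subtype.ext (P.eq_of_mem_parts s.2 t.2 h (hr t))
    · exact (hmem.1 (hr ⟨P.part x, P.part_mem.2 (mem_univ x)⟩)).symm

theorem pow_eq_sum_stirling2_mul_descFactorial (m n : ℕ) :
    m ^ n = ∑ k ∈ range (n + 1), stirling2 n k * m.descFactorial k := by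
  classical
  have hcard : m ^ n =
      ∑ P : Finpartition (univ : Finset (Fin n)), m.descFactorial P.parts.card := by
    have h := Fintype.card_of_bijective
      (bijective_sigma_parts_embedding (α := Fin n) (β := Fin m))
    simpa using h.symm
  have hmaps : ∀ P ∈ (univ : Finset (Finpartition (univ : Finset (Fin n)))),
      P.parts.card ∈ range (n + 1) := fun P _ ↦ by
    have := P.card_parts_le_card
    simp only [card_univ, Fintype.card_fin] at this
    exact mem_range.2 (by omega)
  rw [hcard, ← sum_fiberwise_of_maps_to hmaps]
  refine sum_congr rfl fun k _ ↦ ?_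
  rw [sum_congr rfl fun P hP ↦ by rw [(mem_filter.1 hP).2], sum_const, smul_eq_mul, stirling2,
    Nat.card_eq_fintype_card, Fintype.card_subtype]

open ProbabilityTheory in
/-- Factorial moment identity for the Poisson distribution. -/
theorem hasSum_poisson_mul_descFactorial (r : NNReal) (k : ℕ) {h : ℕ → ℝ}
    (hh : ∃ C, ∀ m, |h m| ≤ C) :
    HasSum (fun m ↦ Real.exp (-r) * r ^ m / m.factorial * (m.descFactorial k * h m))
      (r ^ k * ∫ m, h (m + k) ∂poissonMeasure r) := by
  obtain ⟨C, hC⟩ := hh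
  have hint : Integrable (fun m ↦ h (m + k)) (poissonMeasure r) :=
    .of_bound .of_discrete C (.of_forall fun m ↦ hC (m + k))
  have hsum := (hasSum_integral_poissonMeasure hint).mul_left ((r : ℝ) ^ k)
  have hzero : ∑ m ∈ range k,
      Real.exp (-r) * r ^ m / m.factorial * (m.descFactorial k * h m) = 0 :=
    sum_eq_zero fun m hm ↦ by
      simp [Nat.descFactorial_eq_zero_iff_lt.2 (mem_range.1 hm)]
  rw [← hasSum_nat_add_iff' k, hzero, sub_zero]
  convert! hsum using 2 with m
  have hfac : (m.factorial : ℝ) * (m + k).descFactorial k = (m + k).factorial := by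
    have := Nat.factorial_mul_descFactorial (Nat.le_add_left k m)
    rw [Nat.add_sub_cancel] at this
    exact_mod_cast this
  have hm : (m.factorial : ℝ) ≠ 0 := by positivity
  have hmk : ((m + k).descFactorial k : ℝ) ≠ 0 := fun h0 ↦ by
    rw [h0, mul_zero] at hfac
    exact (m + k).factorial_ne_zero (by exact_mod_cast hfac.symm)
  rw [← hfac, smul_eq_mul]
  field_simp
  ring

theorem stmt0 {Ω : Type*} [MeasurableSpace Ω] (μ : Measure Ω) [IsProbabilityMeasure μ]
    (lam : ℝ) (hlam : 0 ≤ lam) (Z : Ω → ℕ) (hZ : Measurable Z)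
    (hdist : ∀ m : ℕ, μ {ω | Z ω = m} =
      ENNReal.ofReal (Real.exp (-lam) * lam ^ m / Nat.factorial m))
    (f g : ℕ → ℝ) (hf : ∃ C, ∀ m, |f m| ≤ C) (hg : ∃ C, ∀ m, |g m| ≤ C) (n : ℕ) :
    ∫ ω, f (Z ω) * ((Z ω : ℝ) * g (Z ω)) ^ n ∂μ =
      ∑ k ∈ Finset.range (n + 1),
        (stirling2 n k : ℝ) * lam ^ k * ∫ ω, f (Z ω + k) * g (Z ω + k) ^ n ∂μ := by
  lift lam to NNReal using hlam
  have hmap : μ.map Z = ProbabilityTheory.poissonMeasure lam := by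
    refine Measure.ext_of_singleton fun m ↦ ?_
    rw [ProbabilityTheory.poissonMeasure_singleton, ← hdist,
      Measure.map_apply hZ (measurableSet_singleton m)]
    rfl
  have htrans (F : ℕ → ℝ) :
      ∫ ω, F (Z ω) ∂μ = ∫ m, F m ∂ProbabilityTheory.poissonMeasure lam := by
    rw [← hmap, integral_map hZ.aemeasurable .of_discrete]
  have hbdd : ∃ C, ∀ m, |f m * g m ^ n| ≤ C := by
    obtain ⟨C, hC⟩ := hf
    obtain ⟨D, hD⟩ := hg
    refine ⟨C * D ^ n, fun m ↦ ?_⟩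
    rw [abs_mul, abs_pow]
    have := (abs_nonneg _).trans (hC m)
    gcongr
    exacts [hC m, hD m]
  have hsum := hasSum_sum fun k (_ : k ∈ range (n + 1)) ↦
    (hasSum_poisson_mul_descFactorial lam k hbdd).mul_left (stirling2 n k : ℝ)
  rw [htrans fun m ↦ f m * ((m : ℝ) * g m) ^ n, ProbabilityTheory.integral_poissonMeasure]
  simp_rw [fun k ↦ htrans fun m ↦ f (m + k) * g (m + k) ^ n, mul_assoc]
  rw [← hsum.tsum_eq]
  refine tsum_congr fun m ↦ ?_
  have hpow : (m : ℝ) ^ n = ∑ k ∈ range (n + 1), (stirling2 n k : ℝ) * m.descFactorial k := by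
    exact_mod_cast pow_eq_sum_stirling2_mul_descFactorial m n
  rw [smul_eq_mul, mul_pow, hpow, sum_mul, mul_sum, mul_sum]
  exact sum_congr rfl fun k _ ↦ by ring
end

section
/- Let λ ≥ 0, let Z be a random variable with the Poisson distribution of parameter λ, and let f : ℕ → ℝ be a bounded function. Then for every t ∈ ℝ, E[f(Z) e^{tZ}] = ∑_{k=0}^∞ (λ^k / k!) · (e^t − 1)^k · E[f(Z+k)], the series on the right-hand side being absolutely convergent. -/
open MeasureTheory Finset

open ProbabilityTheory
open scoped NNReal Nat

/-- A measurable `ℕ`-valued random variable whose point masses are those of the Poisson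
distribution has the Poisson measure as its law. -/
lemma map_eq_poissonMeasure {Ω : Type*} [MeasurableSpace Ω] {μ : Measure Ω} {r : ℝ≥0}
    {Z : Ω → ℕ} (hZ : Measurable Z)
    (hdist : ∀ m : ℕ, μ {ω | Z ω = m} = ENNReal.ofReal (Real.exp (-r) * r ^ m / m !)) :
    μ.map Z = poissonMeasure r := by
  refine Measure.ext_of_singleton fun m ↦ ?_
  rw [Measure.map_apply hZ (measurableSet_singleton m), poissonMeasure_singleton, ← hdist]
  rfl

lemma integrable_poissonMeasure_of_bounded (r : ℝ≥0) {f : ℕ → ℝ} {C : ℝ} (hf : ∀ m, |f m| ≤ C) :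
    Integrable f (poissonMeasure r) :=
  .of_bound .of_discrete C (.of_forall hf)

/-- The Cauchy product of the exponential series `∑ x ^ k / k!` and `∑ y ^ l / l!`, term by term. -/
lemma sum_antidiagonal_pow_div_factorial_mul (x y : ℝ) (n : ℕ) :
    ∑ p ∈ antidiagonal n, x ^ p.1 / p.1 ! * (y ^ p.2 / p.2 !) = (x + y) ^ n / n ! := by
  rw [(Commute.all x y).add_pow', sum_div]
  refine sum_congr rfl fun p hp ↦ ?_
  rw [← mem_antidiagonal.mp hp, ← Nat.add_choose_mul_factorial_mul_factorial p.1 p.2]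
  have := Nat.cast_ne_zero (R := ℝ).mpr (Nat.choose_pos (Nat.le_add_right p.1 p.2)).ne'
  rw [Nat.choose_symm_add] at this ⊢
  push_cast
  rw [nsmul_eq_mul]
  field_simp

lemma summable_pow_div_factorial_mul_poisson_mul (r : ℝ≥0) (x : ℝ) {f : ℕ → ℝ} {C : ℝ}
    (hf : ∀ m, |f m| ≤ C) :
    Summable fun p : ℕ × ℕ ↦
      x ^ p.1 / p.1 ! * (Real.exp (-r) * r ^ p.2 / p.2 ! * f (p.2 + p.1)) := by
  have hx : Summable fun k : ℕ ↦ |x ^ k / k !| := (Real.summable_pow_div_factorial x).abs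
  have hr := (hasSum_one_poissonMeasure r).summable
  refine .of_norm_bounded
    ((hx.mul_of_nonneg hr (fun _ ↦ abs_nonneg _) fun _ ↦ by positivity).mul_right C) fun p ↦ ?_
  have hp : 0 ≤ Real.exp (-r) * r ^ p.2 / p.2 ! := by positivity
  rw [Real.norm_eq_abs, abs_mul, abs_mul, abs_of_nonneg hp, ← mul_assoc]
  gcongr
  exact hf _

/-- Expansion of a Poisson expectation tilted by `s ^ n`, in powers of `s - 1`. -/
lemma hasSum_integral_mul_pow_poissonMeasure (r : ℝ≥0) (s : ℝ) {f : ℕ → ℝ} {C : ℝ}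
    (hf : ∀ m, |f m| ≤ C) :
    HasSum (fun k : ℕ ↦ r ^ k / k ! * (s - 1) ^ k * ∫ m, f (m + k) ∂poissonMeasure r)
      (∫ m, f m * s ^ m ∂poissonMeasure r) := by
  have hG := (summable_pow_div_factorial_mul_poisson_mul r (r * (s - 1)) hf).hasSum
  have hrow (k : ℕ) : HasSum
      (fun m : ℕ ↦ (r * (s - 1)) ^ k / k ! * (Real.exp (-r) * r ^ m / m ! * f (m + k)))
      ((r * (s - 1)) ^ k / k ! * ∫ m, f (m + k) ∂poissonMeasure r) := by
    have h := hasSum_integral_poissonMeasure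
      (integrable_poissonMeasure_of_bounded r fun m ↦ hf (m + k))
    simp only [smul_eq_mul] at h
    exact h.mul_left ((r * (s - 1)) ^ k / k !)
  have hrows := hG.prod_fiberwise hrow
  have hdiag := (HasAntidiagonal.sigmaAntidiagonalEquivProd.hasSum_iff.mpr hG).sigma
    fun n ↦ hasSum_fintype _
  have hterm : (fun k : ℕ ↦ r ^ k / k ! * (s - 1) ^ k * ∫ m, f (m + k) ∂poissonMeasure r) =
      fun k : ℕ ↦ (r * (s - 1)) ^ k / k ! * ∫ m, f (m + k) ∂poissonMeasure r := by
    ext k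
    rw [mul_pow]
    ring
  rw [hterm]
  have hval : ∫ m, f m * s ^ m ∂poissonMeasure r = ∑' p : ℕ × ℕ,
      (r * (s - 1)) ^ p.1 / p.1 ! * (Real.exp (-r) * r ^ p.2 / p.2 ! * f (p.2 + p.1)) := by
    rw [← hdiag.tsum_eq, integral_poissonMeasure]
    refine tsum_congr fun n ↦ ?_
    have hn := sum_antidiagonal_pow_div_factorial_mul (r * (s - 1)) r n
    rw [show (r : ℝ) * (s - 1) + r = r * s by ring, mul_pow] at hn
    rw [smul_eq_mul, show Real.exp (-r) * r ^ n / n ! * (f n * s ^ n) =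
      r ^ n * s ^ n / n ! * (Real.exp (-r) * f n) by ring, ← hn, sum_mul, ← sum_coe_sort]
    refine sum_congr rfl fun p _ ↦ ?_
    have hp : p.1.2 + p.1.1 = n := by rw [add_comm]; exact mem_antidiagonal.mp p.2
    simp only [Function.comp_apply, HasAntidiagonal.sigmaAntidiagonalEquivProd_apply, hp]
    ring
  rw [hval]
  exact hrows

theorem stmt4 {Ω : Type*} [MeasurableSpace Ω] (μ : Measure Ω) [IsProbabilityMeasure μ]
    (lam : ℝ) (hlam : 0 ≤ lam) (Z : Ω → ℕ) (hZ : Measurable Z)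
    (hdist : ∀ m : ℕ, μ {ω | Z ω = m} =
      ENNReal.ofReal (Real.exp (-lam) * lam ^ m / Nat.factorial m))
    (f : ℕ → ℝ) (hf : ∃ C, ∀ m, |f m| ≤ C) (t : ℝ) :
    Summable (fun k : ℕ =>
        |lam ^ k / Nat.factorial k * (Real.exp t - 1) ^ k * ∫ ω, f (Z ω + k) ∂μ|) ∧
      ∫ ω, f (Z ω) * Real.exp (t * (Z ω : ℝ)) ∂μ =
        ∑' k : ℕ, lam ^ k / Nat.factorial k * (Real.exp t - 1) ^ k *
          ∫ ω, f (Z ω + k) ∂μ := by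
  obtain ⟨C, hC⟩ := hf
  lift lam to ℝ≥0 using hlam
  have hmap (g : ℕ → ℝ) : ∫ ω, g (Z ω) ∂μ = ∫ m, g m ∂poissonMeasure lam := by
    rw [← map_eq_poissonMeasure hZ hdist, integral_map hZ.aemeasurable .of_discrete]
  have hsum := hasSum_integral_mul_pow_poissonMeasure lam (Real.exp t) hC
  simp_rw [← Real.exp_nat_mul, mul_comm _ t] at hsum
  simp_rw [hmap fun m ↦ f m * Real.exp (t * m), fun k ↦ hmap fun m ↦ f (m + k)]
  exact ⟨hsum.summable.abs, hsum.tsum_eq.symm⟩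
end

section
/- Let λ ≥ 0 and let Z be a random variable with the Poisson distribution of parameter λ. Then for every n ∈ ℕ, E[(Z − λ)^n] = ∑_{k=0}^n λ^k · S₂(n,k), where S₂(n,k) is the number of partitions of a set of n elements into k subsets each of cardinality at least 2. -/
open MeasureTheory Finset

/-- The number of partitions of a set of `n` elements into `k` subsets, each of
cardinality at least `2`. -/
noncomputable def stirling2NoSingleton (n k : ℕ) : ℕ :=
  Nat.card {P : Finpartition (Finset.univ : Finset (Fin n)) //
    P.parts.card = k ∧ ∀ B ∈ P.parts, 2 ≤ B.card}

section NoSingletonPartitions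

variable {α R : Type*} [DecidableEq α] [CommSemiring R]

/-- The partitions of `s` all of whose blocks have at least two elements. -/
def noSingletonPartitions (s : Finset α) : Finset (Finpartition s) :=
  {P | ∀ B ∈ P.parts, 2 ≤ #B}

theorem mem_noSingletonPartitions {s : Finset α} {P : Finpartition s} :
    P ∈ noSingletonPartitions s ↔ ∀ B ∈ P.parts, 2 ≤ #B := by
  simp [noSingletonPartitions]

/-- The generating polynomial, evaluated at `x`, of the number of blocks of the partitions of `s`
without singletons. -/
def noSingletonSum (x : R) (s : Finset α) : R :=
  ∑ P ∈ noSingletonPartitions s, x ^ #P.parts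

theorem noSingletonSum_empty (x : R) : noSingletonSum x (∅ : Finset α) = 1 := by
  have h : noSingletonPartitions (∅ : Finset α) = {Finpartition.empty (Finset α)} := by
    ext P
    have hP : P = Finpartition.empty (Finset α) := Subsingleton.elim (α := Finpartition ⊥) _ _
    subst hP
    simp [mem_noSingletonPartitions, Finpartition.empty]
  rw [noSingletonSum, h, sum_singleton]
  simp [Finpartition.empty]

theorem Finpartition.sigma_ext {S T : Finset α} {P : Finpartition S} {Q : Finpartition T}
    (h : P.parts = Q.parts) : (⟨S, P⟩ : Σ s : Finset α, Finpartition s) = ⟨T, Q⟩ := by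
  obtain rfl : S = T := by rw [← P.sup_parts, ← Q.sup_parts, h]
  rw [Finpartition.ext h]

/-- Adding to a partition of `t ⊂ s` the block formed by `a` and the rest of `s`. -/
def Finpartition.extendInsert {a : α} {s t : Finset α} (ha : a ∉ s) (ht : t ⊆ s)
    (P : Finpartition t) : Finpartition (insert a s) :=
  P.extend (b := insert a s \ t)
    (by rw [Finset.bot_eq_empty, ← nonempty_iff_ne_empty]
        exact ⟨a, by simpa using fun h => ha (ht h)⟩)
    disjoint_sdiff (union_sdiff_of_subset (ht.trans (subset_insert a s)))

theorem noSingletonSum_insert (x : R) {a : α} {s : Finset α} (ha : a ∉ s) :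
    noSingletonSum x (insert a s) = x * ∑ t ∈ s.ssubsets, noSingletonSum x t := by
  have hparts {t : Finset α} (ht : t ⊆ s) (P : Finpartition t) :
      (P.extendInsert ha ht).parts = insert (insert a s \ t) P.parts := rfl
  have hnot {t : Finset α} (ht : t ⊆ s) (P : Finpartition t) {B : Finset α} (hB : B ∈ P.parts) :
      a ∉ B := fun h => ha (ht (P.subset hB h))
  have hfilter {t : Finset α} (ht : t ⊆ s) (P : Finpartition t) :
      {B ∈ (P.extendInsert ha ht).parts | a ∉ B} = P.parts := by
    rw [hparts, filter_insert, if_neg (by simpa using fun h => ha (ht h)),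
      filter_true_of_mem fun B hB => hnot ht P hB]
  unfold noSingletonSum
  rw [mul_sum]
  simp_rw [mul_sum]
  rw [sum_sigma']
  symm
  refine sum_bij
    (fun p hp => p.2.extendInsert ha (mem_ssubsets.1 (mem_sigma.1 hp).1).subset) ?_ ?_ ?_ ?_
  · rintro ⟨t, P⟩ hp
    simp only [mem_sigma, mem_ssubsets, mem_noSingletonPartitions] at hp ⊢
    rw [hparts]
    refine forall_mem_insert _ _ _ |>.2 ⟨?_, hp.2⟩
    rw [card_sdiff_of_subset (hp.1.subset.trans (subset_insert a s)), card_insert_of_notMem ha]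
    have := card_lt_card hp.1
    omega
  · rintro ⟨t, P⟩ hp ⟨u, Q⟩ hq h
    refine Finpartition.sigma_ext ?_
    rw [← hfilter (mem_ssubsets.1 (mem_sigma.1 hp).1).subset P,
      ← hfilter (mem_ssubsets.1 (mem_sigma.1 hq).1).subset Q]
    exact congrArg (fun P : Finpartition (insert a s) => P.parts.filter (a ∉ ·)) h
  · intro Q hQ
    rw [mem_noSingletonPartitions] at hQ
    have haQ : a ∈ Q.part a := Q.mem_part_self.2 (mem_insert_self a s)
    have hpart : Q.part a ∈ Q.parts := Q.part_mem.2 (mem_insert_self a s)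
    have hsup : (Q.parts.erase (Q.part a)).sup id = insert a s \ Q.part a := by
      ext y
      simp only [mem_sup, mem_erase, id_eq, mem_sdiff]
      constructor
      · rintro ⟨B, ⟨hne, hB⟩, hy⟩
        exact ⟨Q.subset hB hy, fun hy' => hne (Q.eq_of_mem_parts hB hpart hy hy')⟩
      · rintro ⟨hy, hy'⟩
        obtain ⟨B, hB, hyB⟩ := Q.exists_mem hy
        exact ⟨B, ⟨by rintro rfl; exact hy' hyB, hB⟩, hyB⟩
    have hss : insert a s \ Q.part a ⊂ s := by
      obtain ⟨b, hb, hba⟩ := exists_mem_ne (hQ _ hpart) a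
      refine ssubset_iff_of_subset (fun y hy => ?_) |>.2 ⟨b, ?_, by simp [hb]⟩
      · obtain ⟨hy, hy'⟩ := mem_sdiff.1 hy
        exact (mem_insert.1 hy).resolve_left (by rintro rfl; exact hy' haQ)
      · exact (mem_insert.1 (Q.part_subset a hb)).resolve_left hba
    refine ⟨⟨_, Q.ofSubset (erase_subset _ _) hsup⟩, ?_, ?_⟩
    · simp only [mem_sigma, mem_ssubsets, mem_noSingletonPartitions]
      exact ⟨hss, fun B hB => hQ B (mem_of_mem_erase hB)⟩
    · refine Finpartition.ext ?_
      rw [hparts, Finset.sdiff_sdiff_eq_self (Q.part_subset a)]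
      exact insert_erase hpart
  · rintro ⟨t, P⟩ hp
    have ht := (mem_ssubsets.1 (mem_sigma.1 hp).1).subset
    rw [hparts, card_insert_of_notMem, pow_succ']
    exact fun h => hnot ht P h (by simpa using fun h => ha (ht h))

theorem noSingletonSum_univ (x : R) (n : ℕ) :
    noSingletonSum x (univ : Finset (Fin n)) =
      ∑ k ∈ range (n + 1), x ^ k * (stirling2NoSingleton n k : R) := by
  rw [noSingletonSum, ← sum_fiberwise_of_maps_to (t := range (n + 1)) (g := fun P => #P.parts)]
  · refine sum_congr rfl fun k _ => ?_
    rw [sum_congr rfl fun P hP => by rw [(mem_filter.1 hP).2], sum_const, nsmul_eq_mul, mul_comm,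
      stirling2NoSingleton, Nat.card_eq_fintype_card, Fintype.card_subtype, noSingletonPartitions,
      filter_filter]
    simp_rw [and_comm]
  · intro P _
    simpa [Nat.lt_succ_iff] using P.card_parts_le_card

end NoSingletonPartitions

theorem hasSum_poisson_mul_iff {lam S : ℝ} (f : ℕ → ℝ) :
    HasSum (fun m : ℕ => Real.exp (-lam) * lam ^ m / m.factorial * (m * f m)) S ↔
      HasSum (fun m : ℕ => lam * (Real.exp (-lam) * lam ^ m / m.factorial * f (m + 1))) S := by
  rw [← hasSum_nat_add_iff' 1]
  simp only [sum_range_one, Nat.cast_zero, zero_mul, mul_zero, sub_zero]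
  refine iff_of_eq (congrArg (HasSum · S) (funext fun m => ?_))
  rw [Nat.factorial_succ]
  push_cast
  field_simp
  ring

theorem hasSum_poisson_sub_pow {α : Type*} [DecidableEq α] (lam : ℝ) (s : Finset α) :
    HasSum (fun m : ℕ => Real.exp (-lam) * lam ^ m / m.factorial * ((m : ℝ) - lam) ^ #s)
      (noSingletonSum lam s) := by
  induction s using Finset.strongInduction with
  | H s ih =>
    rcases s.eq_empty_or_nonempty with rfl | ⟨a, has⟩
    · rw [noSingletonSum_empty]
      convert! (NormedSpace.expSeries_div_hasSum_exp lam).mul_left (Real.exp (-lam)) using 1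
      · simp [mul_div_assoc]
      · simp [← Real.exp_eq_exp_ℝ, ← Real.exp_add]
    · obtain ⟨t, hat, rfl⟩ : ∃ t, a ∉ t ∧ insert a t = s :=
        ⟨s.erase a, notMem_erase a s, insert_erase has⟩
      have hsub {u : Finset α} (hu : u ⊆ t) := ih u (hu.trans_ssubset (ssubset_insert hat))
      have hshift := (hasSum_sum fun u (hu : u ∈ t.powerset) =>
        hsub (mem_powerset.1 hu)).mul_left lam
      have hmul : HasSum (fun m : ℕ => Real.exp (-lam) * lam ^ m / m.factorial *
          (m * ((m : ℝ) - lam) ^ #t)) (lam * ∑ u ∈ t.powerset, noSingletonSum lam u) := by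
        rw [hasSum_poisson_mul_iff fun m => ((m : ℝ) - lam) ^ #t]
        refine hshift.congr_fun fun m => ?_
        rw [← mul_sum, Nat.cast_succ, add_sub_right_comm, ← sum_pow_mul_eq_add_pow]
        simp
      convert! hmul.sub ((hsub Subset.rfl).mul_left lam) using 1
      · ext m
        rw [card_insert_of_notMem hat]
        ring
      · rw [noSingletonSum_insert lam hat, ← mul_sub, ssubsets,
          ← add_sum_erase _ _ (mem_powerset_self t), add_sub_cancel_left]

theorem stmt5 {Ω : Type*} [MeasurableSpace Ω] (μ : Measure Ω) [IsProbabilityMeasure μ]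
    (lam : ℝ) (hlam : 0 ≤ lam) (Z : Ω → ℕ) (hZ : Measurable Z)
    (hdist : ∀ m : ℕ, μ {ω | Z ω = m} =
      ENNReal.ofReal (Real.exp (-lam) * lam ^ m / Nat.factorial m))
    (n : ℕ) :
    ∫ ω, ((Z ω : ℝ) - lam) ^ n ∂μ =
      ∑ k ∈ Finset.range (n + 1), lam ^ k * (stirling2NoSingleton n k : ℝ) := by
  lift lam to NNReal using hlam
  have hmap : μ.map Z = ProbabilityTheory.poissonMeasure lam := by
    refine Measure.ext_of_singleton fun m => ?_
    rw [Measure.map_apply hZ (measurableSet_singleton m),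
      ProbabilityTheory.poissonMeasure_singleton]
    exact hdist m
  rw [← integral_map (f := fun m : ℕ => ((m : ℝ) - lam) ^ n) hZ.aemeasurable .of_discrete, hmap,
    ProbabilityTheory.integral_poissonMeasure, ← noSingletonSum_univ]
  simpa using (hasSum_poisson_sub_pow (lam : ℝ) (univ : Finset (Fin n))).tsum_eq
end

section
/- For every n ∈ ℕ, the polynomial identity ∑_{k=0}^n λ^k · S₂(n,k) = ∑_{c=0}^n (−1)^c · C(n,c) · λ^c · B_{n−c}(λ) holds for all real λ, where S₂(n,k) is the number of partitions of a set of n elements into k subsets each of cardinality at least 2, B_m(λ) = ∑_{k=0}^m λ^k S(m,k) is the Bell polynomial of order m, and C(n,c) is the binomial coefficient. -/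
open Finset

/-- The Bell polynomial of order `n`. -/
noncomputable def bellPoly (n : ℕ) (x : ℝ) : ℝ :=
  ∑ k ∈ Finset.range (n + 1), x ^ k * stirling2 n k

namespace Finpartition

variable {α β : Type*} [DecidableEq α] [DecidableEq β]

/-- The image of a finite partition under an embedding. -/
def mapEmb (f : α ↪ β) {s : Finset α} (P : Finpartition s) : Finpartition (s.map f) :=
  ofExistsUnique (P.parts.map (Finset.mapEmbedding f).toEmbedding)
    (by
      simp only [Finset.mem_map]
      rintro _ ⟨B, hB, rfl⟩
      exact Finset.map_subset_map.2 (P.subset hB))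
    (by
      simp only [Finset.mem_map]
      rintro _ ⟨a, ha, rfl⟩
      obtain ⟨B, ⟨hB, haB⟩, huniq⟩ := P.existsUnique_mem ha
      refine ⟨B.map f, ⟨⟨B, hB, rfl⟩, Finset.mem_map_of_mem f haB⟩, ?_⟩
      rintro _ ⟨⟨C, hC, rfl⟩, haC⟩
      exact congrArg (Finset.map f) (huniq C ⟨hC, (Finset.mem_map' f).1 haC⟩))
    (by
      simp only [Finset.mem_map]
      rintro ⟨B, hB, h⟩
      exact P.ne_empty hB (Finset.map_eq_empty.1 h))

theorem parts_mapEmb (f : α ↪ β) {s : Finset α} (P : Finpartition s) :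
    (P.mapEmb f).parts = P.parts.map (Finset.mapEmbedding f).toEmbedding :=
  rfl

theorem mapEmb_injective (f : α ↪ β) (s : Finset α) :
    Function.Injective (mapEmb f : Finpartition s → Finpartition (s.map f)) := fun _ _ h ↦
  Finpartition.ext (Finset.map_injective _ (congrArg Finpartition.parts h))

theorem mapEmb_surjective (f : α ↪ β) (s : Finset α) :
    Function.Surjective (mapEmb f : Finpartition s → Finpartition (s.map f)) := by
  intro Q
  have key : ∀ B ∈ Q.parts, ∃ C ⊆ s, C.map f = B := fun B hB ↦ by
    obtain ⟨C, hC, h⟩ := Finset.subset_map_iff.1 (Q.subset hB)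
    exact ⟨C, hC, h.symm⟩
  refine ⟨ofExistsUnique (s.powerset.filter fun C ↦ C.map f ∈ Q.parts) ?_ ?_ ?_, ?_⟩
  · intro p hp
    exact Finset.mem_powerset.1 (Finset.mem_filter.1 hp).1
  · intro a ha
    obtain ⟨B, hB, haB⟩ := Q.exists_mem (Finset.mem_map_of_mem f ha)
    obtain ⟨C, hC, rfl⟩ := key B hB
    refine ⟨C, ⟨by simp [hC, hB], (Finset.mem_map' f).1 haB⟩, ?_⟩
    rintro D ⟨hD, haD⟩
    exact Finset.map_injective f (Q.eq_of_mem_parts (Finset.mem_filter.1 hD).2 hB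
      (Finset.mem_map_of_mem f haD) haB)
  · intro h
    exact Q.empty_notMem_parts (by simpa using (Finset.mem_filter.1 h).2)
  · ext B
    simp only [parts_mapEmb, ofExistsUnique, Finset.mem_map, Finset.mem_filter,
      Finset.mem_powerset]
    constructor
    · rintro ⟨C, ⟨-, hC⟩, rfl⟩
      exact hC
    · intro hB
      obtain ⟨C, hC, rfl⟩ := key B hB
      exact ⟨C, ⟨hC, hB⟩, rfl⟩

/-- Adjoin every element of `t` as a singleton block to a partition of `s \ t`. -/
def adjoinSingletons {s t : Finset α} (hts : t ⊆ s) (P : Finpartition (s \ t)) :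
    Finpartition s :=
  ofExistsUnique (P.parts ∪ t.image singleton)
    (by
      intro B hB
      rcases Finset.mem_union.1 hB with hB | hB
      · exact (P.subset hB).trans Finset.sdiff_subset
      · obtain ⟨a, ha, rfl⟩ := Finset.mem_image.1 hB
        exact Finset.singleton_subset_iff.2 (hts ha))
    (by
      intro a ha
      by_cases hat : a ∈ t
      · refine ⟨{a}, ⟨Finset.mem_union_right _ (Finset.mem_image_of_mem _ hat),
          Finset.mem_singleton_self a⟩, ?_⟩
        rintro B ⟨hB, haB⟩
        rcases Finset.mem_union.1 hB with hB | hB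
        · exact absurd hat (Finset.mem_sdiff.1 (P.subset hB haB)).2
        · obtain ⟨b, hb, rfl⟩ := Finset.mem_image.1 hB
          rw [Finset.mem_singleton.1 haB]
      · obtain ⟨B, ⟨hB, haB⟩, huniq⟩ := P.existsUnique_mem (Finset.mem_sdiff.2 ⟨ha, hat⟩)
        refine ⟨B, ⟨Finset.mem_union_left _ hB, haB⟩, ?_⟩
        rintro C ⟨hC, haC⟩
        rcases Finset.mem_union.1 hC with hC | hC
        · exact huniq C ⟨hC, haC⟩
        · obtain ⟨b, hb, rfl⟩ := Finset.mem_image.1 hC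
          exact absurd (Finset.mem_singleton.1 haC ▸ hb) hat)
    (by
      intro h
      rcases Finset.mem_union.1 h with h | h
      · exact P.empty_notMem_parts h
      · obtain ⟨b, -, hb⟩ := Finset.mem_image.1 h
        exact Finset.singleton_ne_empty b hb)

theorem parts_adjoinSingletons {s t : Finset α} (hts : t ⊆ s) (P : Finpartition (s \ t)) :
    (P.adjoinSingletons hts).parts = P.parts ∪ t.image singleton :=
  rfl

theorem disjoint_parts_image_singleton {s t : Finset α} (P : Finpartition (s \ t)) :
    Disjoint P.parts (t.image singleton) := by
  rw [Finset.disjoint_right]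
  intro B hB hP
  obtain ⟨a, ha, rfl⟩ := Finset.mem_image.1 hB
  exact (Finset.mem_sdiff.1 (P.subset hP (Finset.mem_singleton_self a))).2 ha

theorem card_parts_adjoinSingletons {s t : Finset α} (hts : t ⊆ s)
    (P : Finpartition (s \ t)) : #(P.adjoinSingletons hts).parts = #P.parts + #t := by
  rw [parts_adjoinSingletons, Finset.card_union_of_disjoint P.disjoint_parts_image_singleton,
    Finset.card_image_of_injective _ Finset.singleton_injective]

theorem adjoinSingletons_injective {s t : Finset α} (hts : t ⊆ s) :
    Function.Injective (adjoinSingletons hts) := by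
  intro P Q h
  have h' : P.parts ∪ t.image singleton = Q.parts ∪ t.image singleton :=
    congrArg Finpartition.parts h
  ext1
  rw [← Finset.union_sdiff_cancel_right P.disjoint_parts_image_singleton, h',
    Finset.union_sdiff_cancel_right Q.disjoint_parts_image_singleton]

theorem exists_adjoinSingletons_eq {s t : Finset α} (hts : t ⊆ s) (P : Finpartition s)
    (h : ∀ a ∈ t, {a} ∈ P.parts) : ∃ Q, adjoinSingletons hts Q = P := by
  have hsub : t.image singleton ⊆ P.parts := Finset.image_subset_iff.2 h
  refine ⟨P.ofSubset (parts := P.parts \ t.image singleton) Finset.sdiff_subset ?_, ?_⟩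
  · ext a
    simp only [Finset.mem_sup, Finset.mem_sdiff, id]
    constructor
    · rintro ⟨B, ⟨hB, hBt⟩, haB⟩
      refine ⟨P.subset hB haB, fun hat ↦ hBt ?_⟩
      rw [P.eq_of_mem_parts hB (h a hat) haB (Finset.mem_singleton_self a)]
      exact Finset.mem_image_of_mem _ hat
    · rintro ⟨ha, hat⟩
      obtain ⟨B, hB, haB⟩ := P.exists_mem ha
      refine ⟨B, ⟨hB, fun hBt ↦ hat ?_⟩, haB⟩
      obtain ⟨b, hb, rfl⟩ := Finset.mem_image.1 hBt
      exact Finset.mem_singleton.1 haB ▸ hb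
  · ext1
    exact Finset.sdiff_union_of_subset hsub

/-- The partitions of `s` having all elements of `t` as singleton blocks correspond to the
partitions of `s \ t`. -/
theorem sum_pow_card_parts_of_singletons_mem {R : Type*} [CommSemiring R] {s t : Finset α}
    (hts : t ⊆ s) (x : R) :
    ∑ P : Finpartition s with ∀ a ∈ t, {a} ∈ P.parts, x ^ #P.parts =
      x ^ #t * ∑ P : Finpartition (s \ t), x ^ #P.parts := by
  rw [Finset.mul_sum]
  symm
  refine Finset.sum_bij (fun P _ ↦ adjoinSingletons hts P) ?_ ?_ ?_ ?_
  · intro P _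
    simp only [Finset.mem_filter, Finset.mem_univ, true_and, parts_adjoinSingletons]
    exact fun a ha ↦ Finset.mem_union_right _ (Finset.mem_image_of_mem _ ha)
  · exact fun P _ Q _ h ↦ adjoinSingletons_injective hts h
  · intro P hP
    obtain ⟨Q, hQ⟩ := exists_adjoinSingletons_eq hts P (Finset.mem_filter.1 hP).2
    exact ⟨Q, Finset.mem_univ Q, hQ⟩
  · intro P _
    rw [card_parts_adjoinSingletons, pow_add, mul_comm]

theorem forall_two_le_card_iff {s : Finset α} (P : Finpartition s) :
    (∀ B ∈ P.parts, 2 ≤ #B) ↔ {a ∈ s | {a} ∈ P.parts} = (∅ : Finset α) := by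
  rw [Finset.filter_eq_empty_iff]
  constructor
  · intro h a _ ha
    simpa using h _ ha
  · intro h B hB
    by_contra hlt
    have hpos := (P.nonempty_of_mem_parts hB).card_pos
    obtain ⟨a, rfl⟩ := Finset.card_eq_one.1 (show #B = 1 by lia)
    exact h (P.subset hB (Finset.mem_singleton_self a)) hB

/-- Inclusion-exclusion over the set of singleton blocks. -/
theorem sum_pow_card_parts_of_two_le_card {R : Type*} [CommRing R] (s : Finset α) (x : R) :
    ∑ P : Finpartition s with ∀ B ∈ P.parts, 2 ≤ #B, x ^ #P.parts =
      ∑ t ∈ s.powerset, (-1) ^ #t * x ^ #t * ∑ P : Finpartition (s \ t), x ^ #P.parts := by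
  have hind (P : Finpartition s) : (if ∀ B ∈ P.parts, 2 ≤ #B then x ^ #P.parts else 0) =
      ∑ t ∈ s.powerset, if ∀ a ∈ t, {a} ∈ P.parts then (-1) ^ #t * x ^ #P.parts else 0 := by
    have hfilter : {t ∈ s.powerset | ∀ a ∈ t, {a} ∈ P.parts} =
        ({a ∈ s | {a} ∈ P.parts} : Finset α).powerset := by
      ext t
      simp only [Finset.mem_filter, Finset.mem_powerset, Finset.subset_iff]
      exact ⟨fun h a ha ↦ ⟨h.1 ha, h.2 a ha⟩, fun h ↦ ⟨fun a ha ↦ (h ha).1, fun a ha ↦ (h ha).2⟩⟩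
    have halt := congrArg (Int.cast : ℤ → R)
      (Finset.sum_powerset_neg_one_pow_card (x := {a ∈ s | {a} ∈ P.parts}))
    push_cast at halt
    rw [← Finset.sum_filter, hfilter, ← Finset.sum_mul, halt]
    simp only [forall_two_le_card_iff]
    split_ifs <;> simp
  rw [Finset.sum_filter, Finset.sum_congr rfl fun P _ ↦ hind P, Finset.sum_comm]
  refine Finset.sum_congr rfl fun t ht ↦ ?_
  rw [← Finset.sum_filter, ← Finset.mul_sum,
    sum_pow_card_parts_of_singletons_mem (Finset.mem_powerset.1 ht), mul_assoc]

theorem sum_pow_mul_natCard {R : Type*} [CommSemiring R] (s : Finset α)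
    (p : Finpartition s → Prop) [DecidablePred p] (x : R) :
    ∑ k ∈ range (#s + 1), x ^ k * (Nat.card {P : Finpartition s // #P.parts = k ∧ p P} : R) =
      ∑ P : Finpartition s with p P, x ^ #P.parts := by
  rw [← Finset.sum_fiberwise_of_maps_to (s := {P : Finpartition s | p P})
    (t := range (#s + 1)) (g := fun P ↦ #P.parts)
    fun P _ ↦ Finset.mem_range_succ_iff.2 P.card_parts_le_card]
  refine Finset.sum_congr rfl fun k _ ↦ ?_
  rw [Finset.sum_congr rfl fun P hP ↦ congrArg (x ^ ·) (Finset.mem_filter.1 hP).2,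
    Finset.sum_const, nsmul_eq_mul, mul_comm, Nat.card_eq_fintype_card, Fintype.card_subtype,
    Finset.filter_filter]
  simp only [and_comm]

theorem sum_pow_mul_natCard_two_le_card {R : Type*} [CommRing R] (s : Finset α) (x : R) :
    ∑ k ∈ range (#s + 1), x ^ k *
        (Nat.card {P : Finpartition s // #P.parts = k ∧ ∀ B ∈ P.parts, 2 ≤ #B} : R) =
      ∑ t ∈ s.powerset, (-1) ^ #t * x ^ #t * ∑ P : Finpartition (s \ t), x ^ #P.parts :=
  (sum_pow_mul_natCard s _ x).trans (sum_pow_card_parts_of_two_le_card s x)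

end Finpartition

theorem bellPoly_card {α : Type*} [DecidableEq α] (s : Finset α) (x : ℝ) :
    bellPoly #s x = ∑ P : Finpartition s, x ^ #P.parts := by
  let f : Fin #s ↪ α := s.equivFin.symm.toEmbedding.trans (Function.Embedding.subtype _)
  have hf : (univ : Finset (Fin #s)).map f = s := by
    rw [← Finset.map_map, Finset.map_univ_equiv]
    exact Finset.attach_map_val
  have hfin := Finpartition.sum_pow_mul_natCard (univ : Finset (Fin #s)) (fun _ ↦ True) x
  simp only [and_true, Finset.card_fin, Finset.filter_true] at hfin
  have hmap : ∑ P : Finpartition (univ : Finset (Fin #s)), x ^ #P.parts =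
      ∑ P : Finpartition ((univ : Finset (Fin #s)).map f), x ^ #P.parts :=
    Fintype.sum_bijective (Finpartition.mapEmb f)
      ⟨Finpartition.mapEmb_injective f _, Finpartition.mapEmb_surjective f _⟩ _ _ fun P ↦ by
        rw [Finpartition.parts_mapEmb, Finset.card_map]
  rw [hf] at hmap
  exact hfin.trans hmap

theorem stmt15 (n : ℕ) (lam : ℝ) :
    ∑ k ∈ Finset.range (n + 1), lam ^ k * (stirling2NoSingleton n k : ℝ) =
      ∑ c ∈ Finset.range (n + 1),
        (-1 : ℝ) ^ c * (n.choose c : ℝ) * lam ^ c * bellPoly (n - c) lam := by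
  have h := Finpartition.sum_pow_mul_natCard_two_le_card (univ : Finset (Fin n)) lam
  rw [Finset.card_fin] at h
  refine h.trans ?_
  rw [Finset.sum_congr rfl fun t ht ↦ by
      rw [← bellPoly_card, Finset.card_sdiff_of_subset (Finset.mem_powerset.1 ht),
        Finset.card_fin],
    Finset.sum_powerset_apply_card (fun c ↦ (-1) ^ c * lam ^ c * bellPoly (n - c) lam),
    Finset.card_fin]
  refine Finset.sum_congr rfl fun c _ ↦ ?_
  rw [nsmul_eq_mul]
  ring
end
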